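/- Assume equation (E_i) holds for every i ∈ {1,…,2n+1} with i ∉ {n, n+1}. Then X_n′ + v_n·X_n = −Σ_{k=1}^{n−1} v_k·X_k, and X_i′ = 0 for every i ∉ {n, n+2}. -/

import Mathlib

/-!
Context: fix `n ≥ 2`; `v_k, X_k : ℝ → ℂ` (`k = 1,…,2n+1`) are differentiable with
`v_k + v_{2n+2−k} = 0` and `X_k + X_{2n+2−k} = 0`.  `(E_i)` is the equation recorded in
`EEq` below.

STATEMENT 10: assume `(E_i)` for every `i ∈ {1,…,2n+1}` with `i ∉ {n, n+1}`.  Then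
`X_n′ + v_n X_n = −Σ_{k=1}^{n−1} v_k X_k`, and `X_i′ = 0` for every `i ∉ {n, n+2}`.
-/

noncomputable section

/-- Equation `(E_i)`: the vanishing of the coefficient of `∂^{2n−1}` in the image of the
tangent vector `X` under the tangent map of the `i`-th Miura map:
`Σ_{k=1}^{2n+1} v_k·X_k + Σ_{k=1}^{i} (i−k)·X_k′ + Σ_{k=i+1}^{2n+1} (i+2n+1−k)·X_k′ = 0`. -/
def EEq (n : ℕ) (v X : ℕ → ℝ → ℂ) (i : ℕ) : Prop :=
  ∀ x : ℝ,
    (∑ k ∈ Finset.Icc 1 (2*n+1), v k x * X k x)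
      + (∑ k ∈ Finset.Icc 1 i, ((i : ℂ) - (k : ℂ)) * deriv (X k) x)
      + (∑ k ∈ Finset.Icc (i+1) (2*n+1),
          ((i : ℂ) + (2*(n : ℂ)+1) - (k : ℂ)) * deriv (X k) x) = 0

lemma aux_split (f : ℕ → ℂ) (i m : ℕ) (h : i ≤ m) :
    ∑ k ∈ Finset.Icc 1 m, f k
      = ∑ k ∈ Finset.Icc 1 i, f k + ∑ k ∈ Finset.Icc (i+1) m, f k := by
  induction m, h using Nat.le_induction with
  | base => simp
  | succ m hm ih =>
    rw [Finset.sum_Icc_succ_top (by omega), Finset.sum_Icc_succ_top (by omega), ih, add_assoc]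

lemma aux_refl (f : ℕ → ℂ) (n : ℕ) :
    ∑ k ∈ Finset.Icc 1 (2*n+1), f k
      = ∑ k ∈ Finset.Icc 1 n, (f k + f (2*n+2-k)) + f (n+1) := by
  rw [aux_split f (n+1) (2*n+1) (by omega), Finset.sum_Icc_succ_top (by omega),
    Finset.sum_add_distrib]
  have : ∑ k ∈ Finset.Icc (n+1+1) (2*n+1), f k = ∑ k ∈ Finset.Icc 1 n, f (2*n+2-k) := by
    refine Finset.sum_nbij' (fun k => 2*n+2-k) (fun k => 2*n+2-k) ?_ ?_ ?_ ?_ ?_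
    · intro k hk; simp only [Finset.mem_Icc] at *; omega
    · intro k hk; simp only [Finset.mem_Icc] at *; omega
    · intro k hk; simp only [Finset.mem_Icc] at *; omega
    · intro k hk; simp only [Finset.mem_Icc] at *; omega
    · intro k hk; simp only [Finset.mem_Icc] at hk; congr 1; omega
  rw [this]; ring

theorem stmt10 (n : ℕ) (hn : 2 ≤ n) (v X : ℕ → ℝ → ℂ)
    (hv : ∀ k ∈ Finset.Icc 1 (2*n+1), Differentiable ℝ (v k))
    (hX : ∀ k ∈ Finset.Icc 1 (2*n+1), Differentiable ℝ (X k))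
    (hvsym : ∀ k ∈ Finset.Icc 1 (2*n+1), ∀ x, v k x + v (2*n+2-k) x = 0)
    (hXsym : ∀ k ∈ Finset.Icc 1 (2*n+1), ∀ x, X k x + X (2*n+2-k) x = 0)
    (hE : ∀ i ∈ Finset.Icc 1 (2*n+1), i ≠ n → i ≠ n+1 → EEq n v X i) :
    (∀ x, deriv (X n) x + v n x * X n x =
        -∑ k ∈ Finset.Icc 1 (n-1), v k x * X k x)
    ∧ (∀ i ∈ Finset.Icc 1 (2*n+1), i ≠ n → i ≠ n+2 → ∀ x, deriv (X i) x = 0) := by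
  have dsym : ∀ k, 1 ≤ k → k ≤ 2*n+1 → ∀ x, deriv (X (2*n+2-k)) x = - deriv (X k) x := by
    intro k h1 h2 x
    have : X (2*n+2-k) = fun y => - X k y := by
      funext y
      have := hXsym k (Finset.mem_Icc.2 ⟨h1, h2⟩) y
      linear_combination this
    rw [this, deriv.fun_neg]
  have dmid : ∀ x, deriv (X (n+1)) x = 0 := by
    intro x
    have := dsym (n+1) (by omega) (by omega) x
    rw [show 2*n+2-(n+1) = n+1 by omega] at this
    exact self_eq_neg.1 this
  have Xmid : ∀ x, X (n+1) x = 0 := by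
    intro x
    have := hXsym (n+1) (Finset.mem_Icc.2 ⟨by omega, by omega⟩) x
    rw [show 2*n+2-(n+1) = n+1 by omega] at this
    exact add_self_eq_zero.1 this
  have dsum : ∀ x, ∑ k ∈ Finset.Icc 1 (2*n+1), deriv (X k) x = 0 := by
    intro x
    rw [aux_refl, dmid, add_zero]
    apply Finset.sum_eq_zero
    intro k hk
    rw [Finset.mem_Icc] at hk
    rw [dsym k (by omega) (by omega)]; ring
  have key : ∀ i, n+2 ≤ i → i ≤ 2*n+1 → ∀ x,
      (∑ k ∈ Finset.Icc 1 (2*n+1), v k x * X k x)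
        - (∑ k ∈ Finset.Icc 1 (2*n+1), (k:ℂ) * deriv (X k) x)
        - (2*(n:ℂ)+1) * ∑ k ∈ Finset.Icc 1 i, deriv (X k) x = 0 := by
    intro i h1 h2 x
    have h := hE i (Finset.mem_Icc.2 ⟨by omega, h2⟩) (by omega) (by omega) x
    have s := dsum x
    have s1 := aux_split (fun k => deriv (X k) x) i _ h2
    have s2 := aux_split (fun k => (k:ℂ) * deriv (X k) x) i _ h2
    simp only [sub_mul, Finset.sum_sub_distrib, ← Finset.mul_sum] at h
    rw [s2]
    rw [s] at s1
    linear_combination h + ((i:ℂ) + 2*n+1) * s1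
  have dhi : ∀ i, n+3 ≤ i → i ≤ 2*n+1 → ∀ x, deriv (X i) x = 0 := by
    intro i h1 h2 x
    obtain ⟨j, rfl⟩ : ∃ j, i = j+1 := ⟨i-1, by omega⟩
    have e1 := key j (by omega) (by omega) x
    have e2 := key (j+1) (by omega) (by omega) x
    rw [Finset.sum_Icc_succ_top (b := j) (by omega) (fun k => deriv (X k) x)] at e2
    have hne : (2*(n:ℂ)+1) ≠ 0 := by exact_mod_cast (by omega : 2*n+1 ≠ 0)
    have : (2*(n:ℂ)+1) * deriv (X (j+1)) x = 0 := by linear_combination e1 - e2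
    exact (mul_eq_zero.1 this).resolve_left hne
  have dlo : ∀ i, 1 ≤ i → i < n → ∀ x, deriv (X i) x = 0 := by
    intro i h1 h2 x
    have := dsym i h1 (by omega) x
    rw [dhi _ (by omega) (by omega)] at this
    exact neg_eq_zero.1 this.symm
  refine ⟨?_, ?_⟩
  · intro x
    have e := key (2*n+1) (by omega) le_rfl x
    rw [dsum, aux_refl, aux_refl, dmid, Xmid] at e
    obtain ⟨m, rfl⟩ : ∃ m, n = m+1 := ⟨n-1, by omega⟩
    have a1 : ∑ k ∈ Finset.Icc 1 (m+1), (v k x * X k x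
        + v (2*(m+1)+2-k) x * X (2*(m+1)+2-k) x)
        = ∑ k ∈ Finset.Icc 1 (m+1), 2 * (v k x * X k x) := by
      apply Finset.sum_congr rfl
      intro k hk
      rw [Finset.mem_Icc] at hk
      have p := hvsym k (Finset.mem_Icc.2 ⟨by omega, by omega⟩) x
      have q := hXsym k (Finset.mem_Icc.2 ⟨by omega, by omega⟩) x
      rw [eq_neg_of_add_eq_zero_right p, eq_neg_of_add_eq_zero_right q]; ring
    rw [a1, ← Finset.mul_sum, Finset.sum_Icc_succ_top (by omega),
      Finset.sum_Icc_succ_top (by omega)] at e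
    rw [Finset.sum_eq_zero (s := Finset.Icc 1 m)
      (f := fun k => (k:ℂ) * deriv (X k) x
        + ((2*(m+1)+2-k : ℕ):ℂ) * deriv (X (2*(m+1)+2-k)) x)] at e
    · rw [dsym (m+1) (by omega) (by omega),
        show 2*(m+1)+2-(m+1) = m+3 by omega] at e
      push_cast at e
      rw [show m+1-1 = m by omega]
      linear_combination e/2
    · intro k hk
      rw [Finset.mem_Icc] at hk
      rw [dsym k (by omega) (by omega), dlo k (by omega) (by omega)]; ring
  · intro i hi h1 h2 x
    rw [Finset.mem_Icc] at hi
    rcases lt_or_ge i n with h | h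
    · exact dlo i hi.1 h x
    · rcases eq_or_ne i (n+1) with rfl | h3
      · exact dmid x
      · exact dhi i (by omega) hi.2 x
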